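/- Let $Z_1, Z_2$ be jointly Gaussian zero-mean processes observed at points $s_1 < \cdots < s_n$ with covariance $\mathrm{Cov}(Z_i(s_l), Z_j(s_m)) = \sigma_i \sigma_j (\rho + (1-\rho)\mathbf{1}_{i=j}) e^{-\theta_0 |s_l - s_m|}$. Then the conditional expectation of $Z_2(s_i)$ given $(Z_1(s_1), \dots, Z_1(s_{i-1}), Z_2(s_1), \dots, Z_2(s_{i-1}))$ equals $e^{-\theta_0 \Delta_i} Z_2(s_{i-1})$, where $\Delta_i = s_i - s_{i-1}$. -/

import Mathlib

open MeasureTheory ProbabilityTheory Real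

lemma aux_indep {Ω : Type*} {m mΩ : MeasurableSpace Ω} {μ : Measure Ω} [IsProbabilityMeasure μ]
    (hle : m ≤ mΩ) {W Y V : Ω → ℝ} (hYm : Measurable[mΩ] Y)
    (hind : Indep (MeasurableSpace.comap Y inferInstance) m μ) (hY0 : ∫ ω, Y ω ∂μ = 0)
    (hV : StronglyMeasurable[m] V) (hYi : Integrable Y μ) (hVi : Integrable V μ)
    (hsum : W = Y + V) : μ[W | m] =ᵐ[μ] V := by
  have hYc : μ[Y | m] =ᵐ[μ] fun _ => ∫ ω, Y ω ∂μ :=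
    condExp_indep_eq hYm.comap_le hle (comap_measurable Y).stronglyMeasurable hind
  have hadd := condExp_add hYi hVi m
  rw [← hsum, condExp_of_stronglyMeasurable hle hV hVi] at hadd
  filter_upwards [hadd, hYc] with ω h1 h2
  rw [h1, Pi.add_apply, h2, hY0, zero_add]

section aux

variable {Ω ι : Type*} [MeasurableSpace Ω] {μ : Measure Ω} [IsProbabilityMeasure μ] [Fintype ι]
  {X : ι → Ω → ℝ} {K : ι → ι → ℝ}

/-- Gaussian linear combinations give a joint Gaussian law. -/
lemma aux_joint (hX : ∀ p, Measurable (X p))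
    (h : ∀ c : ι → ℝ, μ.map (fun ω => ∑ p, c p * X p ω) =
      gaussianReal 0 (Real.toNNReal (∑ p, ∑ q, c p * c q * K p q))) :
    HasGaussianLaw (fun ω p => X p ω) μ where
  isGaussian_map := by
    classical
    refine isGaussian_of_map_eq_gaussianReal fun L => ⟨0, Real.toNNReal (∑ p, ∑ q,
      L (Pi.single p 1) * L (Pi.single q 1) * K p q), ?_⟩
    · rw [Measure.map_map (by fun_prop) (measurable_pi_lambda _ hX)]
      rw [← h (fun p => L (Pi.single p 1))]
      congr 1
      ext ω
      have := L.toLinearMap.pi_apply_eq_sum_univ (fun p => X p ω)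
      simp only [ContinuousLinearMap.coe_coe, smul_eq_mul] at this
      simp only [Function.comp_apply]
      rw [this]
      refine Finset.sum_congr rfl fun p _ => ?_
      rw [mul_comm]
      congr 2
      ext q
      simp [Pi.single_apply, eq_comm]

/-- Mean and variance of a linear combination. -/
lemma aux_mean_var (hX : ∀ p, Measurable (X p))
    (h : ∀ c : ι → ℝ, μ.map (fun ω => ∑ p, c p * X p ω) =
      gaussianReal 0 (Real.toNNReal (∑ p, ∑ q, c p * c q * K p q))) (c : ι → ℝ) :
    ∫ ω, ∑ p, c p * X p ω ∂μ = 0 ∧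
    Var[fun ω => ∑ p, c p * X p ω; μ] =
      (Real.toNNReal (∑ p, ∑ q, c p * c q * K p q) : ℝ) := by
  have hl : HasLaw (fun ω => ∑ p, c p * X p ω)
      (gaussianReal 0 (Real.toNNReal (∑ p, ∑ q, c p * c q * K p q))) μ :=
    ⟨by fun_prop, h c⟩
  exact ⟨by rw [hl.integral_eq, integral_id_gaussianReal],
    by rw [hl.variance_eq, variance_id_gaussianReal]⟩

lemma aux_mean (hX : ∀ p, Measurable (X p))
    (h : ∀ c : ι → ℝ, μ.map (fun ω => ∑ p, c p * X p ω) =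
      gaussianReal 0 (Real.toNNReal (∑ p, ∑ q, c p * c q * K p q))) (p : ι) :
    ∫ ω, X p ω ∂μ = 0 := by
  classical
  simpa [Pi.single_apply] using (aux_mean_var hX h (Pi.single p 1)).1

lemma aux_cov (hX : ∀ p, Measurable (X p))
    (h : ∀ c : ι → ℝ, μ.map (fun ω => ∑ p, c p * X p ω) =
      gaussianReal 0 (Real.toNNReal (∑ p, ∑ q, c p * c q * K p q)))
    (hs : ∀ p q, K p q = K q p) (h0 : ∀ p, 0 ≤ K p p)
    (h1 : ∀ p q, 0 ≤ K p p + 2 * K p q + K q q) (p q : ι) :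
    cov[X p, X q; μ] = K p q := by
  classical
  have hv : ∀ p, Var[X p; μ] = K p p := fun p => by
    have := (aux_mean_var hX h (Pi.single p 1)).2
    simpa [Pi.single_apply, h0 p] using this
  have hm : ∀ p, MemLp (X p) 2 μ := fun p => ((aux_joint hX h).eval p).memLp_two
  have h2 := (aux_mean_var hX h (Pi.single p 1 + Pi.single q 1)).2
  have e1 : (fun ω => ∑ r, (Pi.single p 1 + Pi.single q 1 : ι → ℝ) r * X r ω) = X p + X q := by
    ext ω
    simp [Pi.single_apply, add_mul, Finset.sum_add_distrib]
  have e2 : (∑ r, ∑ t, (Pi.single p 1 + Pi.single q 1 : ι → ℝ) r *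
      (Pi.single p 1 + Pi.single q 1 : ι → ℝ) t * K r t) = K p p + 2 * K p q + K q q := by
    simp [Pi.single_apply, add_mul, mul_add, Finset.sum_add_distrib]
    rw [hs q p]; ring
  rw [e1, e2, Real.coe_toNNReal _ (h1 p q), variance_add (hm p) (hm q), hv, hv] at h2
  linarith

/-- Gaussian regression: if `X a - c X b` is uncorrelated with the conditioning family `X ∘ f`,
which contains `X b`, then the conditional expectation of `X a` is `c X b`. -/
lemma aux_condExp {κ : Type*} [Fintype κ] (hX : ∀ p, Measurable (X p))
    (hG : HasGaussianLaw (fun ω p => X p ω) μ) (hmean : ∀ p, ∫ ω, X p ω ∂μ = 0)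
    (f : κ → ι) (a : ι) (b : κ) (c : ℝ)
    (hc : ∀ r, cov[X (f r), X a; μ] = c * cov[X (f r), X (f b); μ]) :
    μ[X a | MeasurableSpace.comap (fun ω (r : κ) => X (f r) ω) inferInstance]
      =ᵐ[μ] fun ω => c * X (f b) ω := by
  have hm : ∀ p, MemLp (X p) 2 μ := fun p => (hG.eval p).memLp_two
  have hi : ∀ p, Integrable (X p) μ := fun p => (hG.eval p).integrable
  set Y : Ω → ℝ := fun ω => X a ω - c * X (f b) ω with hY
  have hYm : Measurable Y := by fun_prop
  have hpair : HasGaussianLaw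
      (fun ω => ((fun r : κ => X (f r) ω), (fun _ : Unit => Y ω))) μ := by
    let L : (ι → ℝ) →L[ℝ] ((κ → ℝ) × (Unit → ℝ)) :=
      (ContinuousLinearMap.pi fun r => ContinuousLinearMap.proj (f r)).prod
        (ContinuousLinearMap.pi fun _ =>
          ContinuousLinearMap.proj a - c • ContinuousLinearMap.proj (f b))
    exact hG.map_fun L
  have hind := HasGaussianLaw.indepFun_of_covariance_eval
    (X := fun r : κ => X (f r)) (Y := fun _ : Unit => Y) hpair (by
      intro r _
      rw [hY, covariance_fun_sub_right (hm _) (hm _) ((hm _).const_mul c),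
        covariance_const_mul_right, hc, sub_self])
  have hind2 : IndepFun Y (fun ω (r : κ) => X (f r) ω) μ :=
    hind.symm.comp (measurable_pi_apply ()) measurable_id
  have hle := (measurable_pi_lambda _ fun r => hX (f r)).comap_le
  refine aux_indep hle hYm hind2 ?_ ?_ ((hi _).sub ((hi _).const_mul c)) ((hi _).const_mul c) ?_
  · rw [hY, integral_sub (hi _) ((hi _).const_mul c), integral_const_mul, hmean, hmean]; simp
  · have h2 : Measurable (fun x : κ → ℝ => c * x b) := by fun_prop
    exact (h2.comp (comap_measurable (fun ω (r : κ) => X (f r) ω))).stronglyMeasurable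
  · ext ω; simp [hY]

end aux

theorem stmt6 {Ω : Type*} [MeasurableSpace Ω] (μ : Measure Ω) [IsProbabilityMeasure μ]
    (n : ℕ) (s : Fin (n + 1) → ℝ) (hs : StrictMono s)
    (σ : Fin 2 → ℝ) (hσ : ∀ k, 0 < σ k) (ρ θ₀ : ℝ) (hρ : |ρ| < 1) (hθ : 0 < θ₀)
    (Z : Fin 2 → Fin (n + 1) → Ω → ℝ) (hZ : ∀ k j, Measurable (Z k j))
    (hgauss : ∀ c : Fin 2 → Fin (n + 1) → ℝ,
      Measure.map (fun ω => ∑ k, ∑ j, c k j * Z k j ω) μ =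
        gaussianReal 0 (Real.toNNReal (∑ k, ∑ j, ∑ k', ∑ j',
          c k j * c k' j' *
            (σ k * σ k' * (ρ + (1 - ρ) * (if k = k' then 1 else 0)) *
              Real.exp (-θ₀ * |s j - s j'|)))))
    (i : Fin (n + 1)) (hi : 0 < (i : ℕ)) :
    μ[Z 1 i |
        MeasurableSpace.comap
          (fun ω => fun p : Fin 2 × Fin (i : ℕ) => Z p.1 (p.2.castLE i.isLt.le) ω)
          inferInstance]
      =ᵐ[μ] fun ω =>
        Real.exp
            (-θ₀ * (s i - s ⟨(i : ℕ) - 1, Nat.lt_of_le_of_lt (Nat.sub_le _ _) i.isLt⟩)) *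
          Z 1 ⟨(i : ℕ) - 1, Nat.lt_of_le_of_lt (Nat.sub_le _ _) i.isLt⟩ ω := by
  let X : Fin 2 × Fin (n + 1) → Ω → ℝ := fun p => Z p.1 p.2
  let K : Fin 2 × Fin (n + 1) → Fin 2 × Fin (n + 1) → ℝ := fun p q =>
    σ p.1 * σ q.1 * (ρ + (1 - ρ) * (if p.1 = q.1 then 1 else 0)) *
      Real.exp (-θ₀ * |s p.2 - s q.2|)
  have hX : ∀ p, Measurable (X p) := fun p => hZ _ _
  have h : ∀ c : Fin 2 × Fin (n + 1) → ℝ, μ.map (fun ω => ∑ p, c p * X p ω) =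
      gaussianReal 0 (Real.toNNReal (∑ p, ∑ q, c p * c q * K p q)) := by
    intro c
    have := hgauss (fun k j => c (k, j))
    simp only [Fintype.sum_prod_type]
    exact this
  have hsymm : ∀ p q, K p q = K q p := by
    intro p q
    simp only [K, eq_comm (a := p.1), abs_sub_comm (s p.2)]
    ring
  have hdiag : ∀ p, K p p = σ p.1 * σ p.1 := by
    intro p
    simp [K]
  have h0 : ∀ p, 0 ≤ K p p := fun p => by rw [hdiag]; exact mul_self_nonneg _
  have h1 : ∀ p q, 0 ≤ K p p + 2 * K p q + K q q := by
    intro p q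
    rw [hdiag, hdiag]
    obtain ⟨t, ht, hK⟩ : ∃ t : ℝ, |t| ≤ 1 ∧ K p q = σ p.1 * σ q.1 * t := by
      refine ⟨_, ?_, mul_assoc _ _ _⟩
      rw [abs_mul, Real.abs_exp]
      refine mul_le_one₀ ?_ (Real.exp_pos _).le ?_
      · split_ifs <;> simp [hρ.le]
      · rw [Real.exp_le_one_iff]
        nlinarith [abs_nonneg (s p.2 - s q.2)]
    rw [hK]
    have := abs_le.1 ht
    nlinarith [mul_pos (hσ p.1) (hσ q.1), sq_nonneg (σ p.1 - σ q.1)]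
  have hcov := aux_cov hX h hsymm h0 h1
  refine aux_condExp (κ := Fin 2 × Fin (i : ℕ)) hX (aux_joint hX h) (aux_mean hX h)
    (fun r => (r.1, r.2.castLE i.isLt.le)) (1, i) (1, ⟨(i : ℕ) - 1, by omega⟩) _ ?_
  intro r
  rw [hcov, hcov]
  simp only [K]
  have hlt : s (r.2.castLE i.isLt.le) ≤ s i :=
    hs.monotone (by rw [Fin.le_def]; simpa using r.2.isLt.le)
  have hlt' : s (r.2.castLE i.isLt.le) ≤
      s ⟨(i : ℕ) - 1, Nat.lt_of_le_of_lt (Nat.sub_le _ _) i.isLt⟩ :=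
    hs.monotone (by rw [Fin.le_def]; have := r.2.isLt; simp; omega)
  have hcast : (Fin.castLE i.isLt.le (⟨(i : ℕ) - 1, by omega⟩ : Fin (i : ℕ)) : Fin (n + 1)) =
    ⟨(i : ℕ) - 1, Nat.lt_of_le_of_lt (Nat.sub_le _ _) i.isLt⟩ := rfl
  rw [hcast, abs_of_nonpos (by linarith), abs_of_nonpos (by linarith)]
  rw [mul_left_comm, ← Real.exp_add]
  congr 2
  ring
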